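/- Let R be a commutative ring, M an R-module, and 𝔪 a maximal ideal of R. Let 𝔪(+)M denote the ideal { (r,m) : r ∈ 𝔪, m ∈ M } of the trivial extension R(+)M. Then grade_{R(+)M}(𝔪(+)M, R(+)M) = min{ grade_R(𝔪, R), grade_R(𝔪, M) }. -/

import Mathlib

open CategoryTheory

universe u

/-- `M` has a projective resolution `0 → P_n → ⋯ → P_0 → M → 0` of length at most `n`
(the `P_i` projective, not necessarily finitely generated). -/
def HasProjResLE (R : Type u) [CommRing R] :
    ℕ → ∀ (M : Type u) [AddCommGroup M] [Module R M], Prop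
  | 0, M, _, _ => Module.Projective R M
  | n + 1, M, _, _ => ∃ (P : Type u) (_ : AddCommGroup P) (_ : Module R P) (f : P →ₗ[R] M),
      Module.Projective R P ∧ Function.Surjective f ∧ HasProjResLE R n (LinearMap.ker f)

/-- `M` has a finite projective resolution `0 → P_n → ⋯ → P_0 → M → 0` of length `n`
with each `P_i` finitely generated projective. -/
def HasFPRLen (R : Type u) [CommRing R] :
    ℕ → ∀ (M : Type u) [AddCommGroup M] [Module R M], Prop
  | 0, M, _, _ => Module.Finite R M ∧ Module.Projective R M
  | n + 1, M, _, _ => ∃ (P : Type u) (_ : AddCommGroup P) (_ : Module R P) (f : P →ₗ[R] M),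
      Module.Finite R P ∧ Module.Projective R P ∧ Function.Surjective f ∧
        HasFPRLen R n (LinearMap.ker f)

/-- `M` has a finite projective resolution by finitely generated projectives. -/
def HasFPR (R : Type u) [CommRing R] (M : Type u) [AddCommGroup M] [Module R M] : Prop :=
  ∃ n, HasFPRLen R n M

/-- The projective dimension of `M`, as an element of `ℕ∞` (with `⊤` meaning no finite
projective resolution exists). -/
noncomputable def projDim (R : Type u) [CommRing R] (M : Type u) [AddCommGroup M]
    [Module R M] : ℕ∞ :=
  sInf {n : ℕ∞ | ∃ m : ℕ, n = m ∧ HasProjResLE R m M}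

/-- The small finitistic dimension `fPD R`: the supremum, in `ℕ∞`, of the projective
dimensions of `R`-modules having a finite projective resolution. -/
noncomputable def fPD (R : Type u) [CommRing R] : ℕ∞ :=
  ⨆ (M : ModuleCat.{u} R) (_ : HasFPR R M), projDim R M

/-- `Ext_R^n(M, N)` as an `R`-module (object of `ModuleCat R`). -/
noncomputable def ExtMod (R : Type u) [CommRing R] (M N : Type u) [AddCommGroup M] [Module R M]
    [AddCommGroup N] [Module R N] (n : ℕ) : ModuleCat.{u} R :=
  ((Ext R (ModuleCat.{u} R) n).obj (Opposite.op (ModuleCat.of R M))).obj (ModuleCat.of R N)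

/-- The Ext-grade of an ideal `I` on `M`: `inf { p | Ext_R^p(R/I, M) ≠ 0 } ∈ ℕ∞`. -/
noncomputable def extGrade (R : Type u) [CommRing R] (I : Ideal R) (M : Type u) [AddCommGroup M]
    [Module R M] : ℕ∞ :=
  sInf {n : ℕ∞ | ∃ p : ℕ, n = p ∧ ¬ Subsingleton (ExtMod R (R ⧸ I) M p)}

/-- The grade of an arbitrary ideal `J` on `M`: the supremum of the Ext-grades of the
finitely generated ideals contained in `J`. -/
noncomputable def idealGrade (R : Type u) [CommRing R] (J : Ideal R) (M : Type u)
    [AddCommGroup M] [Module R M] : ℕ∞ :=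
  ⨆ (I : Ideal R) (_ : I.FG) (_ : I ≤ J), extGrade R I M

/-- For a module over a commutative ring, the canonical right module structure. -/
noncomputable local instance moduleOpOfModule (R : Type u) [CommRing R] (M : Type u)
    [AddCommGroup M] [Module R M] : Module Rᵐᵒᵖ M :=
  Module.compHom M ((RingHom.id R).fromOpposite mul_comm)

local instance isCentralScalarOfModule (R : Type u) [CommRing R] (M : Type u)
    [AddCommGroup M] [Module R M] : IsCentralScalar R M :=
  ⟨fun _ _ => rfl⟩

section InjectiveHull

variable {R : Type u} [CommRing R]

/-- Every submodule has a maximal disjoint complement, whose quotient is essential over it. -/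
lemma Submodule.exists_disjoint_essential_quotient {E : Type u} [AddCommGroup E] [Module R E]
    (K : Submodule R E) : ∃ C : Submodule R E, Disjoint K C ∧
      ∀ x ∉ C, ∃ r : R, ∃ k ∈ K, k ≠ 0 ∧ r • x - k ∈ C := by
  obtain ⟨C, -, hC, hmax⟩ := zorn_le_nonempty₀ {C : Submodule R E | Disjoint K C} (by
    intro c hc hchain y hy
    refine ⟨sSup c, ?_, fun z hz => le_sSup hz⟩
    refine Submodule.disjoint_def.2 fun x hxK hx => ?_
    obtain ⟨z, hz, hxz⟩ := (Submodule.mem_sSup_of_directed ⟨y, hy⟩ hchain.directedOn).1 hx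
    exact Submodule.disjoint_def.1 (hc hz) x hxK hxz) ⊥ disjoint_bot_right
  refine ⟨C, hC, fun x hx => ?_⟩
  by_contra! hcon
  refine hx (hmax (y := C ⊔ Submodule.span R {x}) ?_ le_sup_left
    (Submodule.mem_sup_right (Submodule.mem_span_singleton_self x)))
  refine Submodule.disjoint_def.2 fun k hkK hk => ?_
  obtain ⟨c, hc, y, hy, rfl⟩ := Submodule.mem_sup.1 hk
  obtain ⟨r, rfl⟩ := Submodule.mem_span_singleton.1 hy
  by_contra hne
  refine hcon r _ hkK hne ?_
  have : r • x - (c + r • x) = -c := by abel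
  rw [this]
  exact C.neg_mem hc

/-- Every module embeds essentially into an injective module. -/
lemma exists_essential_injective (N : Type u) [AddCommGroup N] [Module R N] :
    ∃ (E : Type u) (_ : AddCommGroup E) (_ : Module R E) (f : N →ₗ[R] E),
      Module.Injective R E ∧ Function.Injective f ∧
        ∀ x : E, x ≠ 0 → ∃ (r : R) (n : N), n ≠ 0 ∧ r • x = f n := by
  obtain ⟨E₀, hE₀, j, hj⟩ : ∃ (E₀ : ModuleCat.{u} R) (_ : Module.Injective R E₀)
      (j : N →ₗ[R] E₀), Function.Injective j := by
    let I : ModuleCat.{u} R := Injective.under (ModuleCat.of R N)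
    have hI : Injective (ModuleCat.of R I) := Injective.injective_under (ModuleCat.of R N)
    exact ⟨I, Module.injective_module_of_injective_object R I,
      (Injective.ι (ModuleCat.of R N)).hom, (ModuleCat.mono_iff_injective _).1 inferInstance⟩
  obtain ⟨K, hNK, hK, hmax⟩ := zorn_le_nonempty₀
    {K : Submodule R E₀ | ∀ x ∈ K, x ≠ 0 → ∃ (r : R) (n : N), n ≠ 0 ∧ r • x = j n} (by
      intro c hc hchain y hy
      refine ⟨sSup c, ?_, fun z hz => le_sSup hz⟩
      intro x hx
      obtain ⟨z, hz, hxz⟩ := (Submodule.mem_sSup_of_directed ⟨y, hy⟩ hchain.directedOn).1 hx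
      exact hc hz x hxz) (LinearMap.range j) (by
      rintro _ ⟨n, rfl⟩ hn
      exact ⟨1, n, fun h => hn (by simp [h]), one_smul _ _⟩)
  obtain ⟨C, hdis, hess⟩ := K.exists_disjoint_essential_quotient
  have hKC : Function.Injective (C.mkQ ∘ₗ K.subtype) := by
    rw [← LinearMap.ker_eq_bot, LinearMap.ker_eq_bot']
    intro k hk
    have : (k : E₀) ∈ C := by simpa using hk
    exact Subtype.ext (Submodule.disjoint_def.1 hdis k k.2 this)
  obtain ⟨g, hg⟩ := hE₀.out (C.mkQ ∘ₗ K.subtype) hKC K.subtype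
  have hgK : ∀ k ∈ K, g (C.mkQ k) = k := fun k hk => hg ⟨k, hk⟩
  have hsmul : ∀ x ∉ C, ∃ (r : R), ∃ k ∈ K, k ≠ 0 ∧ r • g (C.mkQ x) = k := by
    intro x hx
    obtain ⟨r, k, hk, hk0, hrk⟩ := hess x hx
    refine ⟨r, k, hk, hk0, ?_⟩
    rw [← map_smul, ← map_smul, ← hgK k hk]
    congr 1
    rwa [Submodule.mkQ_apply, Submodule.mkQ_apply, Submodule.Quotient.eq]
  have hrange : LinearMap.range g ≤ K := by
    refine hmax (y := LinearMap.range g) ?_ fun k hk => ⟨_, hgK k hk⟩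
    rintro _ ⟨y, rfl⟩ hy
    obtain ⟨x, rfl⟩ := C.mkQ_surjective y
    have hx : x ∉ C := fun h => hy (by
      rw [Submodule.mkQ_apply, (Submodule.Quotient.mk_eq_zero C).2 h, map_zero])
    obtain ⟨r, k, hk, hk0, hrk⟩ := hsmul x hx
    obtain ⟨s, n, hn, hsn⟩ := hK k hk hk0
    exact ⟨s * r, n, hn, by rw [mul_smul, hrk, hsn]⟩
  refine ⟨K, inferInstance, inferInstance, j.codRestrict K fun n => hNK ⟨n, rfl⟩, ⟨?_⟩, ?_, ?_⟩
  · intro X Y _ _ _ _ f hf h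
    obtain ⟨h', hh'⟩ := hE₀.out f hf (K.subtype ∘ₗ h)
    refine ⟨(g.codRestrict K fun y => hrange ⟨y, rfl⟩) ∘ₗ C.mkQ ∘ₗ h', fun x => Subtype.ext ?_⟩
    simpa [hh'] using hgK (h x) (h x).2
  · exact fun a b hab => hj (congrArg Subtype.val hab)
  · intro x hx
    obtain ⟨r, n, hn, h⟩ := hK x x.2 fun h => hx (Subtype.ext h)
    exact ⟨r, n, hn, Subtype.ext h⟩

end InjectiveHull

section Ext

variable {R : Type u} [CommRing R]

lemma subsingleton_extMod_iff (M N : Type u) [AddCommGroup M]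
    [Module R M] [AddCommGroup N] [Module R N] (n : ℕ) :
    Subsingleton (ExtMod R M N n) ↔
      Subsingleton (Abelian.Ext (ModuleCat.of R M) (ModuleCat.of R N) n) := by
  let P := projectiveResolution (ModuleCat.of R M)
  rw [← ModuleCat.isZero_iff_subsingleton, ExtMod,
    (P.isoExt (R := R) n (ModuleCat.of R N)).isZero_iff,
    ← HomologicalComplex.exactAt_iff_isZero_homology]
  cases n with
  | zero =>
    rw [HomologicalComplex.exactAt_iff' _ 0 0 1 (by simp) (by simp),
      ShortComplex.moduleCat_exact_iff,
      Abelian.Ext.addEquiv₀.toEquiv.subsingleton_congr]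
    constructor
    · refine fun h => subsingleton_of_forall_eq 0 fun g => ?_
      have hg : P.complex.d 1 0 ≫ P.π.f 0 ≫ (show _ ⟶ ModuleCat.of R N from g) = 0 := by
        rw [P.complex_d_comp_π_f_zero_assoc, Limits.zero_comp]
      obtain ⟨k, hk⟩ := h (P.π.f 0 ≫ g) hg
      have hk' : P.complex.d 0 0 ≫ (show _ ⟶ ModuleCat.of R N from k) = 0 := by
        rw [P.complex.shape 0 0 (by simp), Limits.zero_comp]
      have h0 : P.π.f 0 ≫ (show _ ⟶ ModuleCat.of R N from g) = P.π.f 0 ≫ 0 :=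
        (hk.symm.trans hk').trans Limits.comp_zero.symm
      exact (cancel_epi (P.π.f 0)).1 h0
    · intro h f hf
      obtain ⟨g, hg⟩ := P.exact₀.desc' f hf
      have hg0 : g = 0 := h.elim _ _
      rw [hg0, Limits.comp_zero] at hg
      exact ⟨0, (map_zero _).trans hg⟩
  | succ n =>
    rw [HomologicalComplex.exactAt_iff' _ n (n + 1) (n + 2) (by simp) (by simp),
      ShortComplex.moduleCat_exact_iff]
    constructor
    · refine fun h => subsingleton_of_forall_eq 0 fun α => ?_
      obtain ⟨f, hf, rfl⟩ := P.extMk_surjective α (n + 2) rfl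
      obtain ⟨g, hg⟩ := h f hf
      exact (P.extMk_eq_zero_iff f (n + 2) rfl hf n rfl).2 ⟨g, hg⟩
    · intro h f hf
      obtain ⟨g, hg⟩ := (P.extMk_eq_zero_iff f (n + 2) rfl hf n rfl).1 (Subsingleton.elim _ _)
      exact ⟨g, hg⟩

/-- The elements of `N` annihilated by the ideal `J` are all zero. -/
def TorsionFreeFor (J : Ideal R) (N : Type u) [AddCommGroup N] [Module R N] : Prop :=
  ∀ x : N, (∀ a ∈ J, a • x = 0) → x = 0

lemma torsionFreeFor_map_iff {S : Type u} [CommRing S] [Algebra R S] (J : Ideal R) (N : Type u)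
    [AddCommGroup N] [Module R N] [Module S N] [IsScalarTower R S N] :
    TorsionFreeFor (J.map (algebraMap R S)) N ↔ TorsionFreeFor J N := by
  refine forall_congr' fun x => imp_congr_left ⟨fun h a ha => ?_, fun h a ha => ?_⟩
  · rw [← algebraMap_smul S]
    exact h _ (Ideal.mem_map_of_mem _ ha)
  · refine Submodule.span_induction ?_ (zero_smul S x) ?_ ?_ ha
    · rintro _ ⟨b, hb, rfl⟩
      rw [algebraMap_smul, h b hb]
    · intro a b _ _ ha hb
      rw [add_smul, ha, hb, add_zero]
    · intro r a _ ha
      rw [smul_assoc, ha, smul_zero]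

open Abelian

lemma subsingleton_ext_zero_iff (J : Ideal R) (N : Type u) [AddCommGroup N] [Module R N] :
    Subsingleton (Ext (ModuleCat.of R (R ⧸ J)) (ModuleCat.of R N) 0) ↔ TorsionFreeFor J N := by
  rw [(Ext.addEquiv₀.toEquiv.trans (ModuleCat.homEquiv)).subsingleton_congr]
  constructor
  · intro h x hx
    let f : (R ⧸ J) →ₗ[R] N := J.liftQ (LinearMap.toSpanSingleton R N x) fun a ha => hx a ha
    have hf : f (Submodule.Quotient.mk 1) = x := by
      exact (J.liftQ_apply (LinearMap.toSpanSingleton R N x) (1 : R)).trans (one_smul R x)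
    rw [← hf, Subsingleton.elim f 0, LinearMap.zero_apply]
  · refine fun h => subsingleton_of_forall_eq 0 fun f => Submodule.linearMap_qext _ ?_
    ext
    refine h _ fun a ha => ?_
    have h0 : J.mkQ (a • 1) = 0 := (Submodule.Quotient.mk_eq_zero J).2 (by simpa using ha)
    rw [← map_smul, LinearMap.comp_apply, h0]
    exact map_zero f

lemma subsingleton_ext_of_torsionFreeFor {S : Type u} [CommRing S] [Algebra R S] {J : Ideal R}
    (hJ : J.FG) (E : Type u) [AddCommGroup E] [Module R E] [Module S E] [IsScalarTower R S E]
    (hE : Module.Injective S E) (hJE : TorsionFreeFor J E) (n : ℕ) :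
    Subsingleton (Ext (ModuleCat.of R (R ⧸ J)) (ModuleCat.of R E) n) := by
  classical
  obtain ⟨t, rfl⟩ := hJ
  let f : E →ₗ[S] (t → E) := LinearMap.pi fun a => (a : R) • LinearMap.id
  have hf : Function.Injective f := by
    rw [← LinearMap.ker_eq_bot, LinearMap.ker_eq_bot']
    intro x hx
    refine hJE x fun a ha => ?_
    refine Submodule.span_induction (fun a ha => congrFun hx ⟨a, ha⟩) (zero_smul R x) ?_ ?_ ha
    · intro a b _ _ ha hb
      rw [add_smul, ha, hb, add_zero]
    · intro r a _ ha
      rw [smul_assoc, ha, smul_zero]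
  obtain ⟨r, hr⟩ := hE.out f hf LinearMap.id
  let s (a : t) : ModuleCat.of R E ⟶ ModuleCat.of R E :=
    ModuleCat.ofHom ((r ∘ₗ LinearMap.single S (fun _ => E) a).restrictScalars R)
  have hid : 𝟙 (ModuleCat.of R E) = ∑ a : t, ((a : R) • 𝟙 (ModuleCat.of R E)) ≫ s a := by
    ext x
    have hx : r (∑ a : t, Pi.single a ((a : R) • x)) = x := by
      rw [Finset.univ_sum_single]
      exact hr x
    simpa [s, Pi.single_smul] using hx.symm
  refine subsingleton_of_forall_eq 0 fun α => ?_
  have hα : ∀ a ∈ Ideal.span (t : Set R), a • α = 0 := by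
    intro a ha
    have : a • 𝟙 (ModuleCat.of R (R ⧸ Ideal.span (t : Set R))) = 0 := by
      refine ModuleCat.hom_ext (Submodule.linearMap_qext _ (LinearMap.ext_ring ?_))
      exact (Submodule.Quotient.mk_eq_zero _).2 (by simpa using ha)
    rw [← Ext.mk₀_id_comp α, ← Ext.smul_comp, ← Ext.mk₀_smul, this, Ext.mk₀_zero, Ext.zero_comp]
  rw [← Ext.comp_mk₀_id α, hid, Ext.mk₀_sum, Ext.comp_sum]
  refine Finset.sum_eq_zero fun a _ => ?_
  rw [← Ext.mk₀_comp_mk₀, ← Ext.comp_assoc_of_second_deg_zero, ← Ext.smul_eq_comp_mk₀,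
    hα a (Ideal.subset_span a.2), Ext.zero_comp]

lemma subsingleton_ext_succ_iff {N E : Type u} [AddCommGroup N] [Module R N] [AddCommGroup E]
    [Module R E] {Q : Type u} [AddCommGroup Q] [Module R Q] (f : N →ₗ[R] E) (g : E →ₗ[R] Q)
    (hf : Function.Injective f) (hg : Function.Surjective g) (hfg : Function.Exact f g)
    (X : ModuleCat.{u} R) (hE : ∀ n, Subsingleton (Ext X (ModuleCat.of R E) n)) (n : ℕ) :
    Subsingleton (Ext X (ModuleCat.of R N) (n + 1)) ↔
      Subsingleton (Ext X (ModuleCat.of R Q) n) := by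
  let T : ShortComplex (ModuleCat.{u} R) := ShortComplex.mk (ModuleCat.ofHom f) (ModuleCat.ofHom g)
    (by ext x; exact hfg.apply_apply_eq_zero x)
  have hT : T.ShortExact :=
    { exact := (ShortComplex.ShortExact.moduleCat_exact_iff_function_exact T).2 hfg
      mono_f := (ModuleCat.mono_iff_injective _).2 hf
      epi_g := (ModuleCat.epi_iff_surjective _).2 hg }
  have hE' : ∀ n, Subsingleton (Ext X T.X₂ n) := hE
  constructor
  · intro h
    have : Subsingleton (Ext X T.X₁ (n + 1)) := h
    refine subsingleton_of_forall_eq 0 fun α => ?_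
    obtain ⟨β, rfl⟩ := Ext.covariant_sequence_exact₃ X hT α rfl (Subsingleton.elim _ _)
    rw [Subsingleton.elim β 0, Ext.zero_comp]
  · intro h
    have : Subsingleton (Ext X T.X₃ n) := h
    refine subsingleton_of_forall_eq 0 fun α => ?_
    obtain ⟨β, rfl⟩ := Ext.covariant_sequence_exact₁ X hT α (Subsingleton.elim _ _) rfl
    rw [Subsingleton.elim β 0, Ext.zero_comp]

end Ext

section Comparison

open Abelian

/-- `Ext^i(R/J, N)` vanishes for all `i < p`. -/
def ExtVanishesBelow {R : Type u} [CommRing R] (J : Ideal R) (N : Type u) [AddCommGroup N]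
    [Module R N] (p : ℕ) : Prop :=
  ∀ i < p, Subsingleton (Ext (ModuleCat.of R (R ⧸ J)) (ModuleCat.of R N) i)

lemma natCast_le_extGrade_iff {R : Type u} [CommRing R] (J : Ideal R) (N : Type u)
    [AddCommGroup N] [Module R N] (p : ℕ) :
    (p : ℕ∞) ≤ extGrade R J N ↔ ExtVanishesBelow J N p := by
  rw [extGrade, le_sInf_iff]
  constructor
  · intro h i hi
    rw [← subsingleton_extMod_iff]
    by_contra hne
    exact absurd (h i ⟨i, rfl, hne⟩) (by simpa using hi)
  · rintro h _ ⟨i, rfl, hi⟩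
    rw [subsingleton_extMod_iff] at hi
    by_contra hlt
    exact hi (h i (by simpa using hlt))

lemma extGrade_le_extGrade_iff {R S : Type u} [CommRing R] [CommRing S] {I : Ideal R}
    {J : Ideal S} {M N : Type u} [AddCommGroup M] [Module R M] [AddCommGroup N] [Module S N] :
    extGrade R I M ≤ extGrade S J N ↔
      ∀ p, ExtVanishesBelow I M p → ExtVanishesBelow J N p := by
  simp only [← natCast_le_extGrade_iff]
  exact ENat.forall_natCast_le_iff_le.symm

lemma extVanishesBelow_succ_iff {R S : Type u} [CommRing R] [CommRing S] [Algebra R S]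
    {J : Ideal R} (hJ : J.FG) {N E : Type u} [AddCommGroup N] [Module R N] [Module S N]
    [IsScalarTower R S N] [AddCommGroup E] [Module R E] [Module S E] [IsScalarTower R S E]
    {Q : Type u} [AddCommGroup Q] [Module R Q] [Module S Q] [IsScalarTower R S Q]
    (hE : Module.Injective S E) (hJE : TorsionFreeFor J E) (f : N →ₗ[S] E) (g : E →ₗ[S] Q)
    (hf : Function.Injective f) (hg : Function.Surjective g) (hfg : Function.Exact f g) (p : ℕ) :
    ExtVanishesBelow J N (p + 1) ↔ TorsionFreeFor J N ∧ ExtVanishesBelow J Q p := by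
  have hE' := subsingleton_ext_of_torsionFreeFor hJ E hE hJE
  have key := subsingleton_ext_succ_iff (f.restrictScalars R) (g.restrictScalars R) hf hg hfg
    (ModuleCat.of R (R ⧸ J)) hE'
  rw [← subsingleton_ext_zero_iff]
  constructor
  · exact fun h => ⟨h 0 p.succ_pos, fun i hi => (key i).1 (h (i + 1) (by lia))⟩
  · rintro ⟨h0, h⟩ (_ | i) hi
    · exact h0
    · exact (key i).2 (h i (by lia))

/-- Ext-grades of ideals of two rings over which `S` is an algebra are compared by
comparing torsion-freeness of `S`-modules. -/
lemma extGrade_le_extGrade {R₁ R₂ S : Type u} [CommRing R₁] [CommRing R₂] [CommRing S]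
    [Algebra R₁ S] [Algebra R₂ S] {J₁ : Ideal R₁} {J₂ : Ideal R₂} (h₁ : J₁.FG) (h₂ : J₂.FG)
    (H : ∀ (N : Type u) [AddCommGroup N] [Module S N],
      TorsionFreeFor (J₁.map (algebraMap R₁ S)) N → TorsionFreeFor (J₂.map (algebraMap R₂ S)) N)
    (N : Type u) [AddCommGroup N] [Module S N] [Module R₁ N] [Module R₂ N]
    [IsScalarTower R₁ S N] [IsScalarTower R₂ S N] :
    extGrade R₁ J₁ N ≤ extGrade R₂ J₂ N := by
  have H' (N : Type u) [AddCommGroup N] [Module S N] [Module R₁ N] [Module R₂ N]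
      [IsScalarTower R₁ S N] [IsScalarTower R₂ S N] (h : TorsionFreeFor J₁ N) :
      TorsionFreeFor J₂ N :=
    (torsionFreeFor_map_iff J₂ N).1 (H N ((torsionFreeFor_map_iff J₁ N).2 h))
  rw [extGrade_le_extGrade_iff]
  intro p
  induction p generalizing N with
  | zero => exact fun _ i hi => absurd hi i.not_lt_zero
  | succ p ih =>
    intro hN
    have htf : TorsionFreeFor J₁ N := (subsingleton_ext_zero_iff J₁ N).1 (hN 0 p.succ_pos)
    obtain ⟨E, _, _, f, hE, hf, hess⟩ := exists_essential_injective (R := S) N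
    let _ : Module R₁ E := Module.compHom E (algebraMap R₁ S)
    let _ : Module R₂ E := Module.compHom E (algebraMap R₂ S)
    have : IsScalarTower R₁ S E := IsScalarTower.of_algebraMap_smul fun _ _ => rfl
    have : IsScalarTower R₂ S E := IsScalarTower.of_algebraMap_smul fun _ _ => rfl
    have htfE : TorsionFreeFor J₁ E := by
      intro x hx
      by_contra hne
      obtain ⟨s, n, hn, hsn⟩ := hess x hne
      refine hn (htf n fun a ha => hf ?_)
      rw [map_zero, ← LinearMap.restrictScalars_apply R₁ f, map_smul,
        LinearMap.restrictScalars_apply, ← hsn, smul_comm, hx a ha, smul_zero]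
    have hg := (LinearMap.range f).mkQ_surjective
    have hfg := LinearMap.exact_map_mkQ_range f
    rw [extVanishesBelow_succ_iff h₁ hE htfE f _ hf hg hfg] at hN
    rw [extVanishesBelow_succ_iff h₂ hE (H' E htfE) f _ hf hg hfg]
    exact ⟨H' N htf, ih _ hN.2⟩

lemma extGrade_mono {R : Type u} [CommRing R] {I J : Ideal R} (hI : I.FG) (hJ : J.FG)
    (hIJ : I ≤ J) (N : Type u) [AddCommGroup N] [Module R N] :
    extGrade R I N ≤ extGrade R J N := by
  refine extGrade_le_extGrade (S := R) hI hJ (fun N _ _ h x hx => h x fun a ha => hx a ?_) N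
  exact Ideal.map_mono hIJ ha

end Comparison

section TrivialExtension

variable {R : Type u} [CommRing R] {M : Type u} [AddCommGroup M] [Module R M]

open Abelian

lemma subsingleton_ext_of_retract {A B : Type u} [AddCommGroup A] [Module R A] [AddCommGroup B]
    [Module R B] (i : A →ₗ[R] B) (r : B →ₗ[R] A) (hri : r ∘ₗ i = LinearMap.id)
    (X : ModuleCat.{u} R) (n : ℕ) [Subsingleton (Ext X (ModuleCat.of R B) n)] :
    Subsingleton (Ext X (ModuleCat.of R A) n) := by
  refine subsingleton_of_forall_eq 0 fun α => ?_
  have hid : 𝟙 (ModuleCat.of R A) = ModuleCat.ofHom i ≫ ModuleCat.ofHom r := by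
    rw [← ModuleCat.ofHom_comp, hri, ModuleCat.ofHom_id]
  rw [← Ext.comp_mk₀_id α, hid, ← Ext.mk₀_comp_mk₀, ← Ext.comp_assoc_of_second_deg_zero,
    Subsingleton.elim (α.comp (Ext.mk₀ (ModuleCat.ofHom i)) (add_zero n)) 0, Ext.zero_comp]

lemma subsingleton_ext_trivSqZeroExt_iff (X : ModuleCat.{u} R) (n : ℕ) :
    Subsingleton (Ext X (ModuleCat.of R (TrivSqZeroExt R M)) n) ↔
      Subsingleton (Ext X (ModuleCat.of R R) n) ∧ Subsingleton (Ext X (ModuleCat.of R M) n) := by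
  let i : R →ₗ[R] TrivSqZeroExt R M := Algebra.linearMap R (TrivSqZeroExt R M)
  let r : TrivSqZeroExt R M →ₗ[R] R := (TrivSqZeroExt.fstHom R R M).toLinearMap
  let i' : M →ₗ[R] TrivSqZeroExt R M := TrivSqZeroExt.inrHom R M
  let r' : TrivSqZeroExt R M →ₗ[R] M := TrivSqZeroExt.sndHom R M
  constructor
  · intro h
    exact ⟨subsingleton_ext_of_retract i r (LinearMap.ext fun x => rfl) X n,
      subsingleton_ext_of_retract i' r' (LinearMap.ext fun x => rfl) X n⟩
  · rintro ⟨_, _⟩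
    refine subsingleton_of_forall_eq 0 fun α => ?_
    have hid : 𝟙 (ModuleCat.of R (TrivSqZeroExt R M)) =
        ModuleCat.ofHom r ≫ ModuleCat.ofHom i + ModuleCat.ofHom r' ≫ ModuleCat.ofHom i' :=
      ModuleCat.hom_ext (LinearMap.ext fun x => (TrivSqZeroExt.inl_fst_add_inr_snd_eq x).symm)
    rw [← Ext.comp_mk₀_id α, hid, Ext.mk₀_add, Ext.comp_add, ← Ext.mk₀_comp_mk₀,
      ← Ext.mk₀_comp_mk₀, ← Ext.comp_assoc_of_second_deg_zero,
      ← Ext.comp_assoc_of_second_deg_zero,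
      Subsingleton.elim (α.comp (Ext.mk₀ (ModuleCat.ofHom r)) (add_zero n)) 0,
      Subsingleton.elim (α.comp (Ext.mk₀ (ModuleCat.ofHom r')) (add_zero n)) 0,
      Ext.zero_comp, Ext.zero_comp, add_zero]

lemma extGrade_trivSqZeroExt_eq_min (J : Ideal R) :
    extGrade R J (TrivSqZeroExt R M) = min (extGrade R J R) (extGrade R J M) := by
  have h (p : ℕ) : (p : ℕ∞) ≤ extGrade R J (TrivSqZeroExt R M) ↔
      (p : ℕ∞) ≤ min (extGrade R J R) (extGrade R J M) := by
    simp only [le_min_iff, natCast_le_extGrade_iff, ExtVanishesBelow,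
      subsingleton_ext_trivSqZeroExt_iff, forall_and]
  exact le_antisymm (ENat.forall_natCast_le_iff_le.1 fun p => (h p).1)
    (ENat.forall_natCast_le_iff_le.1 fun p => (h p).2)

open TrivSqZeroExt in
lemma torsionFreeFor_map_fst_iff (I : Ideal (TrivSqZeroExt R M)) (N : Type u) [AddCommGroup N]
    [Module (TrivSqZeroExt R M) N] :
    TorsionFreeFor ((I.map (fstHom R R M)).map (algebraMap R (TrivSqZeroExt R M))) N ↔
      TorsionFreeFor I N := by
  let _ : Module R N := Module.compHom N (algebraMap R (TrivSqZeroExt R M))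
  have : IsScalarTower R (TrivSqZeroExt R M) N := IsScalarTower.of_algebraMap_smul fun _ _ => rfl
  have hmem (r : R) : r ∈ I.map (fstHom R R M) ↔ ∃ z ∈ I, z.fst = r :=
    Ideal.mem_map_iff_of_surjective (fstHom R R M) fst_surjective
  have hsmul (z : TrivSqZeroExt R M) (x : N) :
      z • x = z.fst • x + (inr z.snd : TrivSqZeroExt R M) • x := by
    conv_lhs => rw [← inl_fst_add_inr_snd_eq z, add_smul]
    rfl
  have hinr (m n : M) (x : N) :
      (inr m : TrivSqZeroExt R M) • (inr n : TrivSqZeroExt R M) • x = 0 := by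
    rw [smul_smul, inr_mul_inr, zero_smul]
  rw [torsionFreeFor_map_iff]
  constructor
  · intro h x hx
    have hfst (z) (hz : z ∈ I) : z.fst • x = -((inr z.snd : TrivSqZeroExt R M) • x) :=
      eq_neg_of_add_eq_zero_left (by rw [← hsmul, hx z hz])
    refine h x fun a ha => h _ fun b hb => ?_
    obtain ⟨z, hz, rfl⟩ := (hmem a).1 ha
    obtain ⟨w, hw, rfl⟩ := (hmem b).1 hb
    rw [hfst z hz, smul_neg, smul_comm, hfst w hw, smul_neg, hinr, neg_zero, neg_zero]
  · intro h x hx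
    have hfst (z) (hz : z ∈ I) : z.fst • x = 0 := hx _ ((hmem _).2 ⟨z, hz, rfl⟩)
    refine h x fun z hz => h _ fun w hw => ?_
    rw [hsmul z, hfst z hz, zero_add, hsmul w, hinr, add_zero, smul_comm, hfst w hw, smul_zero]

lemma extGrade_eq_extGrade_map_fst {I : Ideal (TrivSqZeroExt R M)} (hI : I.FG) (N : Type u)
    [AddCommGroup N] [Module (TrivSqZeroExt R M) N] [Module R N]
    [IsScalarTower R (TrivSqZeroExt R M) N] :
    extGrade (TrivSqZeroExt R M) I N =
      extGrade R (I.map (TrivSqZeroExt.fstHom R R M)) N := by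
  have hJ := hI.map (TrivSqZeroExt.fstHom R R M : TrivSqZeroExt R M →+* R)
  refine le_antisymm
    (extGrade_le_extGrade (S := TrivSqZeroExt R M) hI hJ (fun N _ _ h => ?_) N)
    (extGrade_le_extGrade (S := TrivSqZeroExt R M) hJ hI (fun N _ _ h => ?_) N)
  · rw [Algebra.algebraMap_self, Ideal.map_id] at h
    exact (torsionFreeFor_map_fst_iff I N).2 h
  · rw [Algebra.algebraMap_self, Ideal.map_id]
    exact (torsionFreeFor_map_fst_iff I N).1 h

end TrivialExtension

/-- For a maximal ideal `𝔪` of `R` and the ideal `𝔪(+)M = {(r, m) : r ∈ 𝔪}` of the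
trivial extension `R(+)M`, one has
`grade_{R(+)M}(𝔪(+)M, R(+)M) = min (grade_R(𝔪, R)) (grade_R(𝔪, M))`. -/
theorem grade_trivSqZeroExt (R : Type u) [CommRing R] (M : Type u) [AddCommGroup M]
    [Module R M] (m : Ideal R) (hm : m.IsMaximal) (mM : Ideal (TrivSqZeroExt R M))
    (hmM : ∀ x : TrivSqZeroExt R M, x ∈ mM ↔ x.fst ∈ m) :
    idealGrade (TrivSqZeroExt R M) mM (TrivSqZeroExt R M) =
      min (idealGrade R m R) (idealGrade R m M) := by
  have hgrade {I : Ideal (TrivSqZeroExt R M)} (hI : I.FG) :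
      extGrade (TrivSqZeroExt R M) I (TrivSqZeroExt R M) =
        min (extGrade R (I.map (TrivSqZeroExt.fstHom R R M)) R)
          (extGrade R (I.map (TrivSqZeroExt.fstHom R R M)) M) := by
    rw [extGrade_eq_extGrade_map_fst hI, extGrade_trivSqZeroExt_eq_min]
  apply le_antisymm
  · refine iSup_le fun I => iSup_le fun hI => iSup_le fun hIm => ?_
    have hJ := hI.map (TrivSqZeroExt.fstHom R R M : TrivSqZeroExt R M →+* R)
    have hJm : I.map (TrivSqZeroExt.fstHom R R M) ≤ m :=
      Ideal.map_le_iff_le_comap.2 fun z hz => (hmM z).1 (hIm hz)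
    rw [hgrade hI]
    exact min_le_min (le_iSup₂_of_le _ hJ (le_iSup_of_le hJm le_rfl))
      (le_iSup₂_of_le _ hJ (le_iSup_of_le hJm le_rfl))
  · simp only [idealGrade, iSup_inf_eq, inf_iSup_eq]
    refine iSup_le fun I => iSup_le fun hI => iSup_le fun hIm =>
      iSup_le fun J => iSup_le fun hJ => iSup_le fun hJm => ?_
    have hIJ : (I ⊔ J).FG := Submodule.FG.sup hI hJ
    have hK := hIJ.map (algebraMap R (TrivSqZeroExt R M))
    have hKm : (I ⊔ J).map (algebraMap R (TrivSqZeroExt R M)) ≤ mM :=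
      Ideal.map_le_iff_le_comap.2 fun r hr => (hmM _).2 (sup_le hIm hJm hr)
    have hfst : ((I ⊔ J).map (algebraMap R (TrivSqZeroExt R M))).map
        (TrivSqZeroExt.fstHom R R M) = I ⊔ J :=
      (Ideal.map_map _ (TrivSqZeroExt.fstHom R R M : TrivSqZeroExt R M →+* R)).trans
        (Ideal.map_id _)
    refine le_iSup₂_of_le _ hK (le_iSup_of_le hKm ?_)
    rw [hgrade hK, hfst]
    exact min_le_min (extGrade_mono hJ hIJ le_sup_right R)
      (extGrade_mono hI hIJ le_sup_left M)
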